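/- arXiv:2002.02567 — 4 statements merged into one kernel-verified Lean document; each statement's English description precedes it below -/
import Mathlib

section
/- Let G be a locally finite blockchain DAG, and suppose the set of confirmed vertices of G is infinite. Then the subgraph of G induced on the set of confirmed vertices is one-ended. -/
/-- An infinite path in a directed graph with edge relation `E`: an injective sequence of
vertices which is either forward-directed or backward-directed along edges. -/
def InfinitePath {V : Type*} (E : V → V → Prop) (p : ℕ → V) : Prop :=
  Function.Injective p ∧
    ((∀ i, E (p i) (p (i + 1))) ∨ (∀ i, E (p (i + 1)) (p i)))

/-- Two infinite paths are equivalent if a third infinite path meets the vertex set of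
each of them in infinitely many vertices. -/
def PathEquiv {V : Type*} (E : V → V → Prop) (p₁ p₂ : ℕ → V) : Prop :=
  ∃ p₃, InfinitePath E p₃ ∧ (Set.range p₃ ∩ Set.range p₁).Infinite ∧
    (Set.range p₃ ∩ Set.range p₂).Infinite

/-- A directed graph is one-ended if it has at least one infinite path and any two
infinite paths are equivalent. -/
def OneEnded {V : Type*} (E : V → V → Prop) : Prop :=
  (∃ p, InfinitePath E p) ∧
    ∀ p₁ p₂, InfinitePath E p₁ → InfinitePath E p₂ → PathEquiv E p₁ p₂

/-- A blockchain DAG on vertex set ℕ: every edge goes from a larger index to a strictly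
smaller index, vertex 0 has no outgoing edges, and every vertex `i ≥ 1` has at least one
outgoing edge. -/
def BlockchainDAG (E : ℕ → ℕ → Prop) : Prop :=
  (∀ i j, E i j → j < i) ∧ (∀ j, ¬ E 0 j) ∧ (∀ i, 1 ≤ i → ∃ j, E i j)

/-- A vertex `b` is confirmed if all but finitely many vertices of index greater than `b`
have a directed path to `b`. -/
def Confirmed (E : ℕ → ℕ → Prop) (b : ℕ) : Prop :=
  {i | b < i ∧ ¬ Relation.ReflTransGen E i b}.Finite

/-- A directed graph is locally finite if every vertex has finite in-degree and finite
out-degree. -/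
def EdgeLocallyFinite {V : Type*} (E : V → V → Prop) : Prop :=
  ∀ v, {u | E u v}.Finite ∧ {u | E v u}.Finite

open Relation in
/-- A confirmed vertex passes confirmation on to everything it reaches. -/
lemma Confirmed.of_reflTransGen {E : ℕ → ℕ → Prop} {b c : ℕ} (hb : Confirmed E b)
    (h : ReflTransGen E b c) : Confirmed E c := by
  refine (hb.union (Set.finite_Iic b)).subset fun i ⟨_, hi⟩ => ?_
  by_cases hib : b < i
  · exact Or.inl ⟨hib, fun hr => hi (hr.trans h)⟩
  · exact Or.inr (not_lt.mp hib)

open Relation in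
/-- A directed path starting at a confirmed vertex stays in the confirmed subgraph. -/
lemma Confirmed.reflTransGen_induced {E : ℕ → ℕ → Prop} {b c : ℕ} (hb : Confirmed E b)
    (h : ReflTransGen E b c) :
    ReflTransGen (fun u v => E u v ∧ Confirmed E u ∧ Confirmed E v) b c := by
  induction h with
  | refl => exact .refl
  | tail hbx hxy ih =>
    exact ih.tail ⟨hxy, hb.of_reflTransGen hbx, hb.of_reflTransGen (hbx.tail hxy)⟩

open Relation in
/-- Every infinite set of vertices contains a later vertex reaching a given confirmed one. -/
lemma Confirmed.exists_reflTransGen {E : ℕ → ℕ → Prop} {b : ℕ} (hb : Confirmed E b)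
    {S : Set ℕ} (hS : S.Infinite) : ∃ y ∈ S, b < y ∧ ReflTransGen E y b := by
  obtain ⟨y, hyS, hy⟩ := (hS.sdiff (hb.union (Set.finite_Iic b))).nonempty
  have hby : b < y := not_le.mp fun h => hy (Or.inr h)
  exact ⟨y, hyS, hby, by_contra fun h => hy (Or.inl ⟨hby, h⟩)⟩

open Relation in
lemma le_of_reflTransGen {R : ℕ → ℕ → Prop} (hR : ∀ i j, R i j → j < i) {a b : ℕ}
    (h : ReflTransGen R a b) : b ≤ a := by
  induction h with
  | refl => exact le_rfl
  | tail _ hxy ih => exact (hR _ _ hxy).le.trans ih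

open Relation in
/-- If each term of an increasing sequence is reachable from the next one along decreasing
edges, then some backward-directed infinite path passes through all the terms. -/
lemma exists_infinitePath_range_subset {R : ℕ → ℕ → Prop} (hR : ∀ i j, R i j → j < i)
    {f : ℕ → ℕ} (hf : StrictMono f) (hreach : ∀ n, ReflTransGen R (f (n + 1)) (f n)) :
    ∃ p, InfinitePath R p ∧ Set.range f ⊆ Set.range p := by
  have hmono : ∀ m n, m ≤ n → ReflTransGen R (f n) (f m) := fun m n hmn => by
    induction n, hmn using Nat.le_induction with
    | base => exact .refl
    | succ n _ ih => exact (hreach n).trans ih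
  have hstep : ∀ x : {x // ∀ n, x ≤ f n → ReflTransGen R (f n) x},
      ∃ y : {x // ∀ n, x ≤ f n → ReflTransGen R (f n) x},
        R y x ∧ ∀ n, x.1 < f n → y.1 ≤ f n := by
    rintro ⟨x, hx⟩
    have hex : ∃ n, x < f n := ⟨x + 1, (Nat.lt_succ_self x).trans_le hf.le_apply⟩
    classical
    have hlt := Nat.find_spec hex
    rcases (hx _ hlt.le).cases_tail with h | ⟨y, hy, hyx⟩
    · exact absurd h hlt.ne
    have hle : ∀ n, x < f n → ReflTransGen R (f n) y := fun n hn =>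
      (hmono _ _ (Nat.find_min' hex hn)).trans hy
    exact ⟨⟨y, fun n hn => hle n ((hR _ _ hyx).trans_le hn)⟩, hyx,
      fun n hn => le_of_reflTransGen hR (hle n hn)⟩
  choose next hnext hbound using hstep
  let q : ℕ → {x // ∀ n, x ≤ f n → ReflTransGen R (f n) x} := fun k =>
    Nat.rec ⟨f 0, fun n _ => hmono 0 n n.zero_le⟩ (fun _ x => next x) k
  have hq : ∀ k, q (k + 1) = next (q k) := fun _ => rfl
  have hedge : ∀ k, R (q (k + 1)).1 (q k).1 := fun k => by rw [hq]; exact hnext _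
  have hqmono : StrictMono fun k => (q k).1 := strictMono_nat_of_lt_succ fun k =>
    hR _ _ (hedge k)
  refine ⟨fun k => (q k).1, ⟨hqmono.injective, Or.inr hedge⟩, ?_⟩
  rintro _ ⟨n, rfl⟩
  by_contra hn
  have hlt : ∀ k, (q k).1 < f n := fun k => by
    refine lt_of_le_of_ne ?_ fun h => hn ⟨k, h⟩
    induction k with
    | zero => exact hf.monotone n.zero_le
    | succ k ih =>
      rw [hq]
      exact hbound _ _ (lt_of_le_of_ne ih fun h => hn ⟨k, h⟩)
  exact (hlt (f n)).not_ge hqmono.le_apply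

open Relation in
/-- Infinite sets of confirmed vertices can be visited in turn by an increasing sequence whose
terms are reachable from the next ones within the confirmed subgraph. -/
lemma exists_strictMono_reflTransGen_confirmed {E : ℕ → ℕ → Prop} {S : ℕ → Set ℕ}
    (hS : ∀ n, (S n).Infinite) (hC : ∀ n, ∀ x ∈ S n, Confirmed E x) :
    ∃ f : ℕ → ℕ, StrictMono f ∧ (∀ n, f n ∈ S n) ∧ ∀ n,
      ReflTransGen (fun u v => E u v ∧ Confirmed E u ∧ Confirmed E v) (f (n + 1)) (f n) := by
  choose next hmem hlt hreach using
    fun (n : ℕ) (x : S n) => (hC n x x.2).exists_reflTransGen (hS (n + 1))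
  let g : ∀ n, S n := fun n =>
    Nat.rec ⟨_, (hS 0).nonempty.choose_spec⟩ (fun n x => ⟨next n x, hmem n x⟩) n
  exact ⟨fun n => (g n).1, strictMono_nat_of_lt_succ fun n => hlt n (g n), fun n => (g n).2,
    fun n => (hC _ _ (g (n + 1)).2).reflTransGen_induced (hreach n (g n))⟩

/-- Any two infinite sets of confirmed vertices are both met infinitely often by some infinite
path in the confirmed subgraph. -/
lemma exists_infinitePath_inter_infinite {E : ℕ → ℕ → Prop} (hE : ∀ i j, E i j → j < i)
    {S T : Set ℕ} (hS : S.Infinite) (hT : T.Infinite) (hSC : ∀ x ∈ S, Confirmed E x)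
    (hTC : ∀ x ∈ T, Confirmed E x) :
    ∃ p, InfinitePath (fun u v => E u v ∧ Confirmed E u ∧ Confirmed E v) p ∧
      (Set.range p ∩ S).Infinite ∧ (Set.range p ∩ T).Infinite := by
  obtain ⟨f, hf, hmem, hreach⟩ := exists_strictMono_reflTransGen_confirmed (E := E)
    (S := fun n => if Even n then S else T) (fun n => by split_ifs <;> assumption)
    (fun n => by split_ifs <;> assumption)
  obtain ⟨p, hp, hfp⟩ := exists_infinitePath_range_subset (fun i j h => hE i j h.1) hf hreach
  refine ⟨p, hp, Set.infinite_of_injective_forall_mem (f := fun n => f (2 * n)) ?_ fun n => ?_,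
    Set.infinite_of_injective_forall_mem (f := fun n => f (2 * n + 1)) ?_ fun n => ?_⟩
  · exact fun a b h => by have := hf.injective h; omega
  · exact ⟨hfp ⟨_, rfl⟩, by simpa using hmem (2 * n)⟩
  · exact fun a b h => by have := hf.injective h; omega
  · exact ⟨hfp ⟨_, rfl⟩, by simpa using hmem (2 * n + 1)⟩

lemma InfinitePath.confirmed {E : ℕ → ℕ → Prop} {p : ℕ → ℕ}
    (hp : InfinitePath (fun u v => E u v ∧ Confirmed E u ∧ Confirmed E v) p) :
    ∀ x ∈ Set.range p, Confirmed E x := by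
  rintro _ ⟨i, rfl⟩
  rcases hp.2 with h | h
  · exact (h i).2.1
  · exact (h i).2.2

/-- If a locally finite blockchain DAG has infinitely many confirmed vertices, then the
subgraph induced on the set of confirmed vertices is one-ended. -/
theorem confirmed_subgraph_one_ended (E : ℕ → ℕ → Prop)
    (hDAG : BlockchainDAG E)
    (hfin : EdgeLocallyFinite E)
    (hinf : {b | Confirmed E b}.Infinite) :
    OneEnded (fun u v => E u v ∧ Confirmed E u ∧ Confirmed E v) := by
  refine ⟨?_, fun p₁ p₂ h₁ h₂ => ?_⟩
  · obtain ⟨p, hp, -⟩ := exists_infinitePath_inter_infinite hDAG.1 hinf hinf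
      (fun _ h => h) (fun _ h => h)
    exact ⟨p, hp⟩
  · exact exists_infinitePath_inter_infinite hDAG.1 (Set.infinite_range_of_injective h₁.1)
      (Set.infinite_range_of_injective h₂.1) h₁.confirmed h₂.confirmed
end

section
/- Let G be a blockchain DAG that is locally finite and one-ended. Then the set of confirmed vertices of G is infinite. -/
open Relation

/-- In a blockchain DAG every vertex has a directed path to vertex `0`. -/
lemma BlockchainDAG.reflTransGen_zero {E : ℕ → ℕ → Prop} (hDAG : BlockchainDAG E) (i : ℕ) :
    ReflTransGen E i 0 := by
  induction i using Nat.strong_induction_on with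
  | _ i ih =>
    rcases Nat.eq_zero_or_pos i with rfl | hi
    · exact .refl
    · obtain ⟨j, hj⟩ := hDAG.2.2 i hi
      exact .head hj (ih j (hDAG.1 i j hj))

/-- In a blockchain DAG every infinite path is directed towards larger indices. -/
lemma InfinitePath.edge_succ {E : ℕ → ℕ → Prop} (hDAG : BlockchainDAG E) {p : ℕ → ℕ}
    (hp : InfinitePath E p) (i : ℕ) : E (p (i + 1)) (p i) := by
  rcases hp.2 with h | h
  · exact absurd (strictAnti_nat_of_succ_lt fun i => hDAG.1 _ _ (h i))
      (not_strictAnti_of_wellFoundedLT p)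
  · exact h i

/-- Later vertices on an infinite path of a blockchain DAG reach the earlier ones. -/
lemma InfinitePath.reflTransGen {E : ℕ → ℕ → Prop} (hDAG : BlockchainDAG E) {p : ℕ → ℕ}
    (hp : InfinitePath E p) {i j : ℕ} (hij : i ≤ j) : ReflTransGen E (p j) (p i) := by
  induction j, hij using Nat.le_induction with
  | base => exact .refl
  | succ j _ ih => exact .head (hp.edge_succ hDAG j) ih

/-- If infinitely many vertices of `A` reach `v`, then infinitely many of them reach some
in-neighbour of `v`. -/
lemma EdgeLocallyFinite.exists_edge_infinite {V : Type*} {E : V → V → Prop}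
    (hfin : EdgeLocallyFinite E) {A : Set V} {v : V} (hv : {i ∈ A | ReflTransGen E i v}.Infinite) :
    ∃ u, E u v ∧ {i ∈ A | ReflTransGen E i u}.Infinite := by
  by_contra! h
  refine hv ((((hfin v).1.biUnion h).insert v).subset ?_)
  rintro i ⟨hiA, hi⟩
  rcases ReflTransGen.cases_tail hi with rfl | ⟨u, hiu, huv⟩
  · exact Set.mem_insert _ _
  · exact Set.mem_insert_of_mem _ (Set.mem_biUnion huv ⟨hiA, hiu⟩)

/-- König's lemma: in a locally finite blockchain DAG, an infinite set of vertices that is closed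
under out-neighbours contains an infinite path. -/
lemma BlockchainDAG.exists_infinitePath {E : ℕ → ℕ → Prop} (hDAG : BlockchainDAG E)
    (hfin : EdgeLocallyFinite E) {A : Set ℕ} (hA : A.Infinite)
    (hclosed : ∀ i ∈ A, ∀ j, E i j → j ∈ A) : ∃ q, InfinitePath E q ∧ ∀ n, q n ∈ A := by
  let S := {v // {i ∈ A | ReflTransGen E i v}.Infinite}
  have hstep (v : S) : ∃ u : S, E u v :=
    let ⟨u, huv, hu⟩ := hfin.exists_edge_infinite v.2
    ⟨⟨u, hu⟩, huv⟩
  choose f hf using hstep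
  let root : S := ⟨0, hA.mono fun i hi => ⟨hi, hDAG.reflTransGen_zero i⟩⟩
  have hedge (n : ℕ) : E (f^[n + 1] root).1 (f^[n] root).1 := by
    rw [Function.iterate_succ_apply']
    exact hf _
  refine ⟨fun n => (f^[n] root).1,
    ⟨(strictMono_nat_of_lt_succ fun n => hDAG.1 _ _ (hedge n)).injective, .inr hedge⟩, fun n => ?_⟩
  obtain ⟨i, hiA, hi⟩ := (f^[n] root).2.nonempty
  show (f^[n] root).1 ∈ A
  generalize (f^[n] root).1 = v at hi ⊢
  induction hi with
  | refl => exact hiA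
  | tail _ hjk ih => exact hclosed _ ih _ hjk

/-- An infinite subset of the intersection of the ranges of two sequences is met by both at
arbitrarily large indices. -/
lemma exists_le_le_eq_of_infinite_range_inter {V : Type*} {p q : ℕ → V}
    (h : (Set.range p ∩ Set.range q).Infinite) (m n : ℕ) :
    ∃ k l, m ≤ k ∧ n ≤ l ∧ p k = q l := by
  obtain ⟨x, ⟨⟨k, rfl⟩, l, hl⟩, hx⟩ :=
    h.exists_notMem_finite (((Set.finite_Iio m).image p).union ((Set.finite_Iio n).image q))
  refine ⟨k, l, ?_, ?_, hl.symm⟩ <;> by_contra! hlt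
  · exact hx (.inl ⟨k, hlt, rfl⟩)
  · exact hx (.inr ⟨l, hlt, hl⟩)

/-- Every vertex on an infinite path of a locally finite one-ended blockchain DAG is confirmed. -/
lemma InfinitePath.confirmed_s2 {E : ℕ → ℕ → Prop} (hDAG : BlockchainDAG E)
    (hfin : EdgeLocallyFinite E) (hone : OneEnded E) {p : ℕ → ℕ} (hp : InfinitePath E p) (i : ℕ) :
    Confirmed E (p i) := by
  by_contra hnot
  obtain ⟨q, hq, hqA⟩ := hDAG.exists_infinitePath hfin (A := {j | ¬ ReflTransGen E j (p i)})
    (Set.Infinite.mono (fun _ hj => hj.2) hnot) fun j hj k hjk hk => hj (.head hjk hk)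
  obtain ⟨r, hr, hrp, hrq⟩ := hone.2 p q hp hq
  obtain ⟨m, j, -, hij, hmj⟩ := exists_le_le_eq_of_infinite_range_inter hrp 0 i
  obtain ⟨k, l, hmk, -, hkl⟩ := exists_le_le_eq_of_infinite_range_inter hrq m 0
  have hqr := hr.reflTransGen hDAG hmk
  rw [hkl, hmj] at hqr
  exact hqA l (hqr.trans (hp.reflTransGen hDAG hij))

/-- If a blockchain DAG is locally finite and one-ended, then it has infinitely many
confirmed vertices. -/
theorem one_ended_infinitely_many_confirmed (E : ℕ → ℕ → Prop)
    (hDAG : BlockchainDAG E)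
    (hfin : EdgeLocallyFinite E)
    (hone : OneEnded E) :
    {b | Confirmed E b}.Infinite := by
  obtain ⟨p, hp⟩ := hone.1
  exact (Set.infinite_range_of_injective hp.1).mono
    (Set.range_subset_iff.mpr (hp.confirmed_s2 hDAG hfin hone))
end

section
/- Let G be a blockchain DAG, and suppose there exists a strictly increasing sequence (n_k)_{k ∈ ℕ} of natural numbers such that for every k, every vertex v with v > n_{k+1} has a directed path in G to every vertex u with u ≤ n_k. Then G is one-ended. -/
/-- In an increasing relation on `ℕ`, consecutive connecting paths can be concatenated into one
infinite path. -/
theorem exists_chain_through_of_transGen {R : ℕ → ℕ → Prop} (hR : ∀ i j, R i j → i < j)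
    (w : ℕ → ℕ) (hw : ∀ k, Relation.TransGen R (w k) (w (k + 1))) :
    ∃ p : ℕ → ℕ, (∀ i, R (p i) (p (i + 1))) ∧ Set.range w ⊆ Set.range p := by
  -- A state `(x, k)` records the current vertex `x` and the index `k` of the next target `w k`.
  have step : ∀ s : {s : ℕ × ℕ // Relation.ReflTransGen R s.1 (w s.2)},
      ∃ t : {s : ℕ × ℕ // Relation.ReflTransGen R s.1 (w s.2)}, R s.1.1 t.1.1 ∧
        t.1.2 = if s.1.1 = w s.1.2 then s.1.2 + 1 else s.1.2 := by
    rintro ⟨⟨x, k⟩, hs⟩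
    by_cases hx : x = w k
    · obtain ⟨y, hxy, hy⟩ := Relation.TransGen.head'_iff.1 (hw k)
      exact ⟨⟨(y, k + 1), hy⟩, by simpa [hx] using hxy, by simp [hx]⟩
    · rcases hs.cases_head with h | ⟨y, hxy, hy⟩
      · exact absurd h hx
      · exact ⟨⟨(y, k), hy⟩, hxy, by simp [hx]⟩
  choose f hfR hf using step
  let s : ℕ → {s : ℕ × ℕ // Relation.ReflTransGen R s.1 (w s.2)} :=
    fun i => f^[i] ⟨(w 0, 0), .refl⟩
  have hs : ∀ i, s (i + 1) = f (s i) := fun i => Function.iterate_succ_apply' f i _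
  have le_of_reach : ∀ {x y}, Relation.ReflTransGen R x y → x ≤ y := fun h => by
    induction h with
    | refl => exact le_rfl
    | tail _ h ih => exact ih.trans (hR _ _ h).le
  have hits : ∀ d i, w (s i).1.2 - (s i).1.1 = d →
      ∃ j, (s j).1.2 = (s i).1.2 ∧ (s j).1.1 = w (s i).1.2 := by
    intro d
    induction d using Nat.strong_induction_on with
    | _ d ih =>
      intro i hd
      by_cases hx : (s i).1.1 = w (s i).1.2
      · exact ⟨i, rfl, hx⟩
      · have hk : (s (i + 1)).1.2 = (s i).1.2 := by rw [hs, hf, if_neg hx]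
        have hlt : (s i).1.1 < (s (i + 1)).1.1 := by rw [hs]; exact hR _ _ (hfR _)
        have hle := le_of_reach (s i).2
        obtain ⟨j, hj⟩ := ih _ (by rw [hk]; omega) (i + 1) rfl
        exact ⟨j, by rwa [hk] at hj⟩
  have reaches : ∀ k, ∃ i, (s i).1.2 = k ∧ (s i).1.1 = w k := by
    intro k
    induction k with
    | zero => exact ⟨0, rfl, rfl⟩
    | succ k ih =>
      obtain ⟨i, hik, hix⟩ := ih
      have hk : (s (i + 1)).1.2 = k + 1 := by rw [hs, hf, if_pos (by rw [hix, hik]), hik]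
      obtain ⟨j, hj⟩ := hits _ (i + 1) rfl
      exact ⟨j, by rwa [hk] at hj⟩
  refine ⟨fun i => (s i).1.1, fun i => ?_, ?_⟩
  · simp only [hs]
    exact hfR _
  · rintro _ ⟨k, rfl⟩
    obtain ⟨i, -, hi⟩ := reaches k
    exact ⟨i, hi⟩

/-- If every vertex is reachable from all sufficiently large vertices, then any two infinite sets
of vertices are met infinitely often by a common infinite path. -/
theorem exists_infinitePath_inter_infinite_s5 {E : ℕ → ℕ → Prop} (hE : ∀ i j, E i j → j < i)
    (hreach : ∀ u, ∃ N, ∀ v, N < v → Relation.TransGen E v u) {A B : Set ℕ}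
    (hA : A.Infinite) (hB : B.Infinite) :
    ∃ p, InfinitePath E p ∧ (Set.range p ∩ A).Infinite ∧ (Set.range p ∩ B).Infinite := by
  have next : ∀ {S : Set ℕ}, S.Infinite → ∀ u, ∃ v ∈ S, u < v ∧ Relation.TransGen E v u := by
    intro S hS u
    obtain ⟨N, hN⟩ := hreach u
    obtain ⟨v, hvS, hv⟩ := hS.exists_gt (max N u)
    exact ⟨v, hvS, (le_max_right _ _).trans_lt hv, hN v ((le_max_left _ _).trans_lt hv)⟩
  choose a haA hlta hpa using next hA
  choose b hbB hltb hpb using next hB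
  let w : ℕ → ℕ := fun k => Nat.rec 0 (fun k x => if Even k then a x else b x) k
  have hw : ∀ k, w (k + 1) = if Even k then a (w k) else b (w k) := fun _ => rfl
  have w_mono : StrictMono w := strictMono_nat_of_lt_succ fun k => by
    rw [hw]; split_ifs
    exacts [hlta _, hltb _]
  obtain ⟨p, hp, hwp⟩ := exists_chain_through_of_transGen (R := Function.swap E)
    (fun i j h => hE j i h) w fun k => by
      rw [Relation.transGen_swap, hw]; split_ifs
      exacts [hpa _, hpb _]
  refine ⟨p, ⟨(strictMono_nat_of_lt_succ fun i => hE _ _ (hp i)).injective, .inr hp⟩, ?_, ?_⟩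
  · refine Set.infinite_of_injective_forall_mem (f := fun k => w (2 * k + 1))
      (fun i j h => by have := w_mono.injective (a₁ := 2 * i + 1) (a₂ := 2 * j + 1) h; omega)
      fun k => ⟨hwp ⟨2 * k + 1, rfl⟩, ?_⟩
    rw [hw, if_pos (even_two_mul k)]
    exact haA _
  · refine Set.infinite_of_injective_forall_mem (f := fun k => w (2 * k + 1 + 1))
      (fun i j h => by
        have := w_mono.injective (a₁ := 2 * i + 1 + 1) (a₂ := 2 * j + 1 + 1) h
        omega)
      fun k => ⟨hwp ⟨2 * k + 1 + 1, rfl⟩, ?_⟩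
    rw [hw, if_neg (Nat.not_even_two_mul_add_one k)]
    exact hbB _

/-- If in a blockchain DAG there is a strictly increasing sequence `n` such that every
vertex of index greater than `n (k+1)` has a directed path to every vertex of index at
most `n k`, then the DAG is one-ended. -/
theorem one_ended_of_cut_sequence (E : ℕ → ℕ → Prop)
    (hDAG : BlockchainDAG E)
    (n : ℕ → ℕ) (hmono : StrictMono n)
    (hpath : ∀ k, ∀ v, n (k + 1) < v → ∀ u, u ≤ n k → Relation.ReflTransGen E v u) :
    OneEnded E := by
  have hreach : ∀ u, ∃ N, ∀ v, N < v → Relation.TransGen E v u := fun u => by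
    refine ⟨n (u + 1), fun v hv => ?_⟩
    have hu : u ≤ n u := hmono.le_apply
    have hlt : n u < n (u + 1) := hmono u.lt_succ_self
    exact (Relation.reflTransGen_iff_eq_or_transGen.1 (hpath u v hv u hu)).resolve_left (by omega)
  refine ⟨?_, fun p₁ p₂ h₁ h₂ => exists_infinitePath_inter_infinite_s5 hDAG.1 hreach
    (Set.infinite_range_of_injective h₁.1) (Set.infinite_range_of_injective h₂.1)⟩
  obtain ⟨p, hp, -⟩ :=
    exists_infinitePath_inter_infinite_s5 hDAG.1 hreach Set.infinite_univ Set.infinite_univ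
  exact ⟨p, hp⟩
end

section
/- There exist directed graphs G and G' on the vertex set ℕ, where G' is obtained from G by adding infinitely many directed edges (each going from a vertex of larger index to a vertex of smaller index), such that G is locally finite and one-ended, while G' contains two infinite paths that are not equivalent in G'. In other words, adding countably many edges to a one-ended locally finite DAG can produce a DAG that is not one-ended. -/
/-- In a graph on `ℕ` all of whose edges go from `v + 2` to `v`, an infinite path climbs in
steps of two. -/
theorem InfinitePath.eq_add_two_mul {E : ℕ → ℕ → Prop} (hE : ∀ u v, E u v → u = v + 2)
    {p : ℕ → ℕ} (hp : InfinitePath E p) :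
    (∀ i, E (p (i + 1)) (p i)) ∧ ∀ i, p i = p 0 + 2 * i := by
  rcases hp.2 with h | h
  · have key : ∀ i, p i + 2 * i = p 0 := by
      intro i
      induction i with
      | zero => rfl
      | succ i ih => have := hE _ _ (h i); omega
    have := key (p 0 + 1)
    omega
  · refine ⟨h, fun i => ?_⟩
    induction i with
    | zero => rfl
    | succ i ih => have := hE _ _ (h i); omega

theorem infinitePath_add_two_mul {E : ℕ → ℕ → Prop} (a : ℕ)
    (h : ∀ i, E (a + 2 * (i + 1)) (a + 2 * i)) : InfinitePath E (fun i => a + 2 * i) :=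
  ⟨fun i j hij => by simpa using hij, Or.inr h⟩

/-- Adding countably many edges (each from a larger index to a smaller index) to a
one-ended locally finite DAG on ℕ can produce a DAG that is not one-ended: there exist
`G ⊆ G'` with infinitely many added edges, `G` locally finite and one-ended, and `G'`
containing two non-equivalent infinite paths. -/
theorem adding_edges_can_break_one_endedness :
    ∃ G G' : ℕ → ℕ → Prop,
      (∀ u v, G u v → G' u v) ∧
      (∀ u v, G u v → v < u) ∧
      (∀ u v, G' u v → ¬ G u v → v < u) ∧
      {e : ℕ × ℕ | G' e.1 e.2 ∧ ¬ G e.1 e.2}.Infinite ∧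
      EdgeLocallyFinite G ∧
      OneEnded G ∧
      ∃ p₁ p₂, InfinitePath G' p₁ ∧ InfinitePath G' p₂ ∧ ¬ PathEquiv G' p₁ p₂ := by
  refine ⟨fun u v => u = v + 2 ∧ v % 2 = 0, fun u v => u = v + 2, fun u v h => h.1,
    fun u v h => by omega, fun u v h _ => by omega, ?_, ?_, ⟨?_, ?_⟩, ?_⟩
  · refine Set.infinite_of_injective_forall_mem (f := fun n : ℕ => (2 * n + 3, 2 * n + 1)) ?_ ?_
    · intro i j hij
      simpa using hij
    · intro n
      exact ⟨rfl, fun h => by have := h.2; omega⟩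
  · refine fun v => ⟨(Set.finite_Iic (v + 2)).subset ?_, (Set.finite_Iic (v + 2)).subset ?_⟩ <;>
    · intro u hu
      simp only [Set.mem_ofPred_eq, Set.mem_Iic] at hu ⊢
      omega
  · exact ⟨_, infinitePath_add_two_mul 0 fun i => by omega⟩
  · intro p q hp hq
    obtain ⟨hpE, hp'⟩ := hp.eq_add_two_mul fun u v h => h.1
    obtain ⟨hqE, hq'⟩ := hq.eq_add_two_mul fun u v h => h.1
    have hp0 := (hpE 0).2
    have hq0 := (hqE 0).2
    refine ⟨p, hp, ?_, ?_⟩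
    · rw [Set.inter_self]
      exact Set.infinite_range_of_injective hp.1
    · refine Set.infinite_of_injective_forall_mem (f := fun n : ℕ => p 0 + q 0 + 2 * n) ?_ ?_
      · intro i j hij
        simpa using hij
      · intro n
        refine ⟨⟨q 0 / 2 + n, ?_⟩, ⟨p 0 / 2 + n, ?_⟩⟩
        · rw [hp']
          omega
        · rw [hq']
          omega
  · refine ⟨_, _, infinitePath_add_two_mul 0 fun i => by omega,
      infinitePath_add_two_mul 1 fun i => by omega, ?_⟩
    rintro ⟨p, hp, h₁, h₂⟩
    obtain ⟨-, hp'⟩ := hp.eq_add_two_mul fun u v h => h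
    obtain ⟨-, ⟨i, rfl⟩, ⟨j, hj⟩⟩ := h₁.nonempty
    obtain ⟨-, ⟨k, rfl⟩, ⟨l, hl⟩⟩ := h₂.nonempty
    have hi := hp' i
    have hk := hp' k
    simp only at hj hl
    omega
end
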